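/- (Theorem 1, Case 2.) Suppose both the cloned key and the original key store the same challenge hash c : α, and consider a protocol trace starting from the empty window whose send values are pairwise distinct. If the user's respond c operation occurs earlier in the trace than the attacker's respond c operation and the user's respond succeeds, then the attacker's respond c fails; that is, the attacker cannot authenticate to the relying party as the user after the user has authenticated. -/

import Mathlib

/-- Remove items from the head of `l` up to and including the first occurrence
of `c`; if `c ∉ l`, the result is `[]`. -/
def removeThrough {α : Type*} [DecidableEq α] (c : α) (l : List α) : List α :=
  (l.dropWhile (fun x => decide (x ≠ c))).tail

/-- An operation in a protocol trace: the relying party sends a challenge hash,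
or an authenticator responds with a stored challenge hash. -/
inductive Op (α : Type*) where
  | send (c : α)
  | respond (c : α)

/-- One step of the relying party's window update. A `send c` appends `c` to the
window; a `respond c` succeeds iff `c` is in the window, in which case the window
is updated to `removeThrough c`; a failed respond leaves the window unchanged. -/
def step {α : Type*} [DecidableEq α] (w : List α) (o : Op α) : List α :=
  match o with
  | .send c => w ++ [c]
  | .respond c => if c ∈ w then removeThrough c w else w

/-- The window after processing a whole trace from initial window `init`. -/
def window {α : Type*} [DecidableEq α] (init : List α) (t : List (Op α)) : List α :=
  t.foldl step init

/-- The list of values of the `send` operations of a trace, in order. -/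
def sends {α : Type*} : List (Op α) → List α :=
  List.filterMap (fun o => match o with | .send c => some c | .respond _ => none)

theorem removeThrough_cons_self {α : Type*} [DecidableEq α] (c : α) (l : List α) :
    removeThrough c (c :: l) = l := by
  simp [removeThrough]

theorem removeThrough_cons_of_ne {α : Type*} [DecidableEq α] {a c : α} (h : a ≠ c)
    (l : List α) : removeThrough c (a :: l) = removeThrough c l := by
  simp [removeThrough, h]

theorem cons_removeThrough_sublist {α : Type*} [DecidableEq α] {c : α} {l : List α}
    (h : c ∈ l) : (c :: removeThrough c l).Sublist l := by
  induction l with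
  | nil => simp at h
  | cons a l ih =>
    by_cases hac : a = c
    · subst hac
      rw [removeThrough_cons_self]
    · rw [removeThrough_cons_of_ne hac]
      exact (ih ((List.mem_cons.mp h).resolve_left (Ne.symm hac))).cons a

theorem removeThrough_sublist {α : Type*} [DecidableEq α] (c : α) (l : List α) :
    (removeThrough c l).Sublist l :=
  (List.tail_sublist _).trans (List.dropWhile_sublist _)

theorem window_sublist {α : Type*} [DecidableEq α] (w : List α) (t : List (Op α)) :
    (window w t).Sublist (w ++ sends t) := by
  induction t generalizing w with
  | nil => simp [window, sends]
  | cons o t ih =>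
    refine (ih (step w o)).trans ?_
    cases o with
    | send c => simp [step, sends]
    | respond c =>
      refine List.Sublist.append ?_ (List.Sublist.refl _)
      simp only [step]
      split
      · exact removeThrough_sublist c w
      · exact List.Sublist.refl w

/-- A successful `respond c` uses up one sent copy of `c`, in addition to all the values
in any later window. -/
theorem cons_window_sublist_sends {α : Type*} [DecidableEq α] {c : α} {p : List (Op α)}
    (h : c ∈ window [] p) (m : List (Op α)) :
    (c :: window [] (p ++ Op.respond c :: m)).Sublist (sends (p ++ Op.respond c :: m)) := by
  have hw : window [] (p ++ Op.respond c :: m) =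
      window (removeThrough c (window [] p)) m := by
    rw [window, List.foldl_append, List.foldl_cons]
    change window (step (window [] p) (Op.respond c)) m = _
    simp [step, h]
  have hs : sends (p ++ Op.respond c :: m) = sends p ++ sends m := by
    simp [sends]
  rw [hw, hs]
  exact ((window_sublist _ m).cons_cons c).trans
    (((cons_removeThrough_sublist h).trans (window_sublist [] p)).append
      (List.Sublist.refl (sends m)))

/-- Theorem 1, Case 2: if the user's `respond c` (at position `i`) occurs
before the attacker's `respond c` (at position `j`) and the user's respond
succeeds, then the attacker's respond fails: the attacker cannot authenticate
as the user. -/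
theorem stmt_6 {α : Type*} [DecidableEq α] (t : List (Op α))
    (hnd : (sends t).Nodup) (c : α) (i j : ℕ) (hij : i < j)
    (husr : t[i]? = some (Op.respond c)) (hatk : t[j]? = some (Op.respond c))
    (hsucc : c ∈ window [] (t.take i)) :
    c ∉ window [] (t.take j) := by
  have hi : i < (t.take j).length := by
    have := (List.getElem?_eq_some_iff.mp hatk).1
    rw [List.length_take]
    omega
  have hget : (t.take j)[i] = Op.respond c := by
    rw [List.getElem_take]
    exact (List.getElem?_eq_some_iff.mp husr).2
  have hsplit : t.take j = t.take i ++ Op.respond c :: (t.take j).drop (i + 1) := by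
    rw [← hget, ← List.drop_eq_getElem_cons hi]
    conv_lhs => rw [← List.take_append_drop i (t.take j)]
    rw [List.take_take, min_eq_left hij.le]
  have hsub := cons_window_sublist_sends hsucc ((t.take j).drop (i + 1))
  rw [← hsplit] at hsub
  exact (List.nodup_cons.mp
    (hnd.sublist (hsub.trans ((List.take_sublist j t).filterMap _)))).1
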